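/- arXiv:0912.5461 — 4 statements merged into one kernel-verified Lean document; each statement's English description precedes it below -/
import Mathlib

section
/- Let B = B₁ ∪ B₂ be an integral decomposition of a finite subset B of Λ, and let D ⊆ B be an irreducible subset. Then D ⊆ B₁ or D ⊆ B₂. -/
open TensorProduct

variable {Λ : Type*} [AddCommGroup Λ]

/-- The completion (saturation) `Δ̄ = {λ ∈ Λ : m • λ ∈ Δ for some m > 0}` of a sublattice. -/
def completion (Δ : Submodule ℤ Λ) : Submodule ℤ Λ where
  carrier := {x | ∃ m : ℤ, 0 < m ∧ m • x ∈ Δ}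
  zero_mem' := ⟨1, one_pos, by rw [one_smul]; exact Δ.zero_mem⟩
  add_mem' := by
    rintro a b ⟨m, hm, hma⟩ ⟨k, hk, hkb⟩
    refine ⟨m * k, mul_pos hm hk, ?_⟩
    rw [show (m * k) • (a + b) = k • (m • a) + m • (k • b) by
      rw [smul_add, mul_comm m k, mul_smul, mul_smul, smul_comm k m b]]
    exact Δ.add_mem (Δ.smul_mem _ hma) (Δ.smul_mem _ hkb)
  smul_mem' := by
    rintro c x ⟨m, hm, hmx⟩
    exact ⟨m, hm, by rw [smul_comm]; exact Δ.smul_mem c hmx⟩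

/-- The completion of the sublattice spanned by a subset `B ⊆ Λ`. -/
def zcomp (B : Set Λ) : Submodule ℤ Λ := completion (Submodule.span ℤ B)

/-- An integral decomposition of `B`: the parts (the elements of the finite family `P`)
are pairwise disjoint and nonempty, they cover `B`, and the completion of `⟨B⟩ℤ` is the
internal direct sum of the completions of the spans of the parts. -/
def IsIntegralDecomp (B : Set Λ) (P : Finset (Set Λ)) : Prop :=
  (∀ p ∈ P, p.Nonempty) ∧
  ((P : Set (Set Λ)).Pairwise fun p q => Disjoint p q) ∧
  ⋃₀ (P : Set (Set Λ)) = B ∧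
  (zcomp B = ⨆ p ∈ P, zcomp p) ∧
  iSupIndep (fun p : P => zcomp (p : Set Λ))

/-- `B` is irreducible if it admits no integral decomposition with at least two parts. -/
def IrreducibleSubset (B : Set Λ) : Prop :=
  ¬ ∃ P : Finset (Set Λ), 2 ≤ P.card ∧ IsIntegralDecomp B P

theorem zcomp_mono {B C : Set Λ} (h : B ⊆ C) : zcomp B ≤ zcomp C := by
  rintro x ⟨m, hm, hx⟩
  exact ⟨m, hm, Submodule.span_mono h hx⟩

theorem span_le_zcomp (B : Set Λ) : Submodule.span ℤ B ≤ zcomp B := fun x hx =>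
  ⟨1, one_pos, by rwa [one_smul]⟩

/-- If the completions of two sets are in direct sum and together contain the completion of
`D₁ ∪ D₂`, where `D₁` and `D₂` are subsets of these sets, then the completion of `D₁ ∪ D₂`
splits. -/
theorem zcomp_union_of_subset {B₁ B₂ D₁ D₂ : Set Λ} (h₁ : D₁ ⊆ B₁) (h₂ : D₂ ⊆ B₂)
    (hle : zcomp (D₁ ∪ D₂) ≤ zcomp B₁ ⊔ zcomp B₂) (hind : Disjoint (zcomp B₁) (zcomp B₂)) :
    zcomp (D₁ ∪ D₂) = zcomp D₁ ⊔ zcomp D₂ := by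
  refine le_antisymm (fun x hx => ?_)
    (sup_le (zcomp_mono Set.subset_union_left) (zcomp_mono Set.subset_union_right))
  obtain ⟨y, hy, z, hz, rfl⟩ := Submodule.mem_sup.1 (hle hx)
  obtain ⟨m, hm, hmx⟩ := hx
  rw [Submodule.span_union] at hmx
  obtain ⟨a, ha, b, hb, hab⟩ := Submodule.mem_sup.1 hmx
  have ha' : a ∈ zcomp B₁ := zcomp_mono h₁ (span_le_zcomp D₁ ha)
  have hb' : b ∈ zcomp B₂ := zcomp_mono h₂ (span_le_zcomp D₂ hb)
  have heq : m • y - a = b - m • z := by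
    rw [sub_eq_sub_iff_add_eq_add, ← smul_add, ← hab, add_comm]
  have hzero : m • y - a = 0 := Submodule.disjoint_def.1 hind _
    (Submodule.sub_mem _ (Submodule.smul_mem _ m hy) ha')
    (heq ▸ Submodule.sub_mem _ hb' (Submodule.smul_mem _ m hz))
  have hya : m • y = a := sub_eq_zero.1 hzero
  have hzb : m • z = b := (sub_eq_zero.1 (heq ▸ hzero)).symm
  exact Submodule.add_mem_sup ⟨m, hm, hya ▸ ha⟩ ⟨m, hm, hzb ▸ hb⟩

open Classical in
/-- A decomposition into two parts, expressed through a two-element family. -/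
theorem isIntegralDecomp_pair {D₁ D₂ : Set Λ} (hne₁ : D₁.Nonempty) (hne₂ : D₂.Nonempty)
    (hdisj : Disjoint D₁ D₂) (hsup : zcomp (D₁ ∪ D₂) = zcomp D₁ ⊔ zcomp D₂)
    (hind : Disjoint (zcomp D₁) (zcomp D₂)) :
    IsIntegralDecomp (D₁ ∪ D₂) {D₁, D₂} := by
  refine ⟨by simp [hne₁, hne₂], ?_, by simp, ?_, ?_⟩
  · rw [Finset.coe_pair, Set.pairwise_pair]
    exact fun _ => ⟨hdisj, hdisj.symm⟩
  · rw [hsup, Finset.iSup_insert, Finset.iSup_singleton]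
  · have hne : D₁ ≠ D₂ := hdisj.ne hne₁.ne_empty
    have h₁ : D₁ ∈ ({D₁, D₂} : Finset (Set Λ)) := by simp
    have h₂ : D₂ ∈ ({D₁, D₂} : Finset (Set Λ)) := by simp
    have hcover : ∀ p : ({D₁, D₂} : Finset (Set Λ)), p = ⟨D₁, h₁⟩ ∨ p = ⟨D₂, h₂⟩ := by
      rintro ⟨p, hp⟩
      simpa only [Subtype.mk.injEq, Finset.mem_insert, Finset.mem_singleton] using hp
    exact (iSupIndep_pair (fun h => hne (congrArg Subtype.val h)) hcover).2 hind

variable [Module.Free ℤ Λ] [Module.Finite ℤ Λ]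

/-- If `B = B₁ ∪ B₂` is an integral decomposition of the finite set `B ⊆ Λ` and `D ⊆ B`
is an irreducible subset, then `D ⊆ B₁` or `D ⊆ B₂`. -/
theorem irreducible_subset_of_binary_decomposition
    (B B₁ B₂ D : Set Λ) (hBfin : B.Finite)
    (hunion : B₁ ∪ B₂ = B) (hne₁ : B₁.Nonempty) (hne₂ : B₂.Nonempty)
    (hdisj : Disjoint B₁ B₂)
    (hsup : zcomp B = zcomp B₁ ⊔ zcomp B₂)
    (hind : Disjoint (zcomp B₁) (zcomp B₂))
    (hDB : D ⊆ B) (hirr : IrreducibleSubset D) :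
    D ⊆ B₁ ∨ D ⊆ B₂ := by
  classical
  by_contra! hcon
  obtain ⟨⟨x, hxD, hx⟩, ⟨y, hyD, hy⟩⟩ := hcon.imp Set.not_subset.1 Set.not_subset.1
  have hne₁' : (D ∩ B₁).Nonempty :=
    ⟨y, hyD, (hunion.symm ▸ hDB hyD : y ∈ B₁ ∪ B₂).resolve_right hy⟩
  have hne₂' : (D ∩ B₂).Nonempty :=
    ⟨x, hxD, (hunion.symm ▸ hDB hxD : x ∈ B₁ ∪ B₂).resolve_left hx⟩
  have hdisj' : Disjoint (D ∩ B₁) (D ∩ B₂) :=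
    hdisj.mono Set.inter_subset_right Set.inter_subset_right
  have hD : D ∩ B₁ ∪ D ∩ B₂ = D := by
    rw [← Set.inter_union_distrib_left, hunion, Set.inter_eq_left.2 hDB]
  have hsplit := zcomp_union_of_subset (Set.inter_subset_right (s := D))
    (Set.inter_subset_right (s := D)) (by rw [hD, ← hsup]; exact zcomp_mono hDB) hind
  refine hirr ⟨{D ∩ B₁, D ∩ B₂}, ?_, ?_⟩
  · rw [Finset.card_pair (hdisj'.ne hne₁'.ne_empty)]
  · have h := isIntegralDecomp_pair hne₁' hne₂' hdisj' hsplit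
      (hind.mono (zcomp_mono Set.inter_subset_right) (zcomp_mono Set.inter_subset_right))
    rw [hD] at h
    convert h
end

section
/- Let B = B₁ ∪ B₂ be an integral decomposition of a finite subset B of Λ, let D ⊆ B, and set D₁ := D ∩ B₁ and D₂ := D ∩ B₂. Then ⟨D⟩_ℤ is the internal direct sum of ⟨D₁⟩_ℤ and ⟨D₂⟩_ℤ, and the completion of ⟨D⟩_ℤ is the internal direct sum of the completions of ⟨D₁⟩_ℤ and ⟨D₂⟩_ℤ (so that D = D₁ ∪ D₂ is an integral decomposition of D whenever both parts are nonempty). -/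
open TensorProduct

variable {Λ : Type*} [AddCommGroup Λ]

theorem le_completion (Δ : Submodule ℤ Λ) : Δ ≤ completion Δ :=
  fun x hx => ⟨1, one_pos, by rwa [one_smul]⟩

theorem completion_mono {Δ Δ' : Submodule ℤ Λ} (h : Δ ≤ Δ') : completion Δ ≤ completion Δ' :=
  fun _ ⟨m, hm, hmx⟩ => ⟨m, hm, h hmx⟩

/-- If a completion is contained in a direct sum of completions, then the same holds for the
completions of smaller sublattices compatible with the sum. -/
theorem completion_sup_le_of_disjoint {P P₁ P₂ Δ₁ Δ₂ : Submodule ℤ Λ}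
    (hP : completion P ≤ completion P₁ ⊔ completion P₂)
    (hind : Disjoint (completion P₁) (completion P₂))
    (hΔ : Δ₁ ⊔ Δ₂ ≤ P) (h₁ : Δ₁ ≤ P₁) (h₂ : Δ₂ ≤ P₂) :
    completion (Δ₁ ⊔ Δ₂) ≤ completion Δ₁ ⊔ completion Δ₂ := by
  intro x hx
  obtain ⟨x₁, hx₁, x₂, hx₂, rfl⟩ := Submodule.mem_sup.1 (hP (completion_mono hΔ hx))
  obtain ⟨m, hm, hmx⟩ := hx
  obtain ⟨d₁, hd₁, d₂, hd₂, hd⟩ := Submodule.mem_sup.1 hmx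
  have hmem₁ : m • x₁ - d₁ ∈ completion P₁ :=
    sub_mem (Submodule.smul_mem _ m hx₁) (le_completion _ (h₁ hd₁))
  have hmem₂ : d₂ - m • x₂ ∈ completion P₂ :=
    sub_mem (le_completion _ (h₂ hd₂)) (Submodule.smul_mem _ m hx₂)
  have heq : m • x₁ - d₁ = d₂ - m • x₂ := by
    rw [sub_eq_sub_iff_add_eq_add, ← smul_add, ← hd, add_comm]
  have hzero₁ : m • x₁ - d₁ = 0 := Submodule.disjoint_def.1 hind _ hmem₁ (heq ▸ hmem₂)
  have hzero₂ : d₂ - m • x₂ = 0 := heq ▸ hzero₁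
  refine Submodule.add_mem_sup ⟨m, hm, ?_⟩ ⟨m, hm, ?_⟩
  · rwa [sub_eq_zero.1 hzero₁]
  · rwa [← sub_eq_zero.1 hzero₂]

variable [Module.Free ℤ Λ] [Module.Finite ℤ Λ]

/-- If `B = B₁ ∪ B₂` is an integral decomposition of the finite set `B ⊆ Λ` and `D ⊆ B`,
then with `D₁ = D ∩ B₁` and `D₂ = D ∩ B₂`, the lattice `⟨D⟩ℤ` is the internal direct sum
of `⟨D₁⟩ℤ` and `⟨D₂⟩ℤ`, and the completion of `⟨D⟩ℤ` is the internal direct sum of the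
completions of `⟨D₁⟩ℤ` and `⟨D₂⟩ℤ` (so `D = D₁ ∪ D₂` is an integral decomposition of `D`
whenever both parts are nonempty). -/
theorem binary_decomposition_restricts
    (B B₁ B₂ D : Set Λ) (hBfin : B.Finite)
    (hunion : B₁ ∪ B₂ = B) (hne₁ : B₁.Nonempty) (hne₂ : B₂.Nonempty)
    (hdisj : Disjoint B₁ B₂)
    (hsup : zcomp B = zcomp B₁ ⊔ zcomp B₂)
    (hind : Disjoint (zcomp B₁) (zcomp B₂))
    (hDB : D ⊆ B) :
    (D ∩ B₁) ∪ (D ∩ B₂) = D ∧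
    Disjoint (D ∩ B₁) (D ∩ B₂) ∧
    (Submodule.span ℤ D = Submodule.span ℤ (D ∩ B₁) ⊔ Submodule.span ℤ (D ∩ B₂)) ∧
    Disjoint (Submodule.span ℤ (D ∩ B₁)) (Submodule.span ℤ (D ∩ B₂)) ∧
    (zcomp D = zcomp (D ∩ B₁) ⊔ zcomp (D ∩ B₂)) ∧
    Disjoint (zcomp (D ∩ B₁)) (zcomp (D ∩ B₂)) := by
  have hD : (D ∩ B₁) ∪ (D ∩ B₂) = D := by
    rw [← Set.inter_union_distrib_left, hunion, Set.inter_eq_left.2 hDB]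
  have hspan : Submodule.span ℤ D =
      Submodule.span ℤ (D ∩ B₁) ⊔ Submodule.span ℤ (D ∩ B₂) := by
    rw [← Submodule.span_union, hD]
  have h₁ : Submodule.span ℤ (D ∩ B₁) ≤ Submodule.span ℤ B₁ :=
    Submodule.span_mono Set.inter_subset_right
  have h₂ : Submodule.span ℤ (D ∩ B₂) ≤ Submodule.span ℤ B₂ :=
    Submodule.span_mono Set.inter_subset_right
  have hcomp : Disjoint (zcomp (D ∩ B₁)) (zcomp (D ∩ B₂)) :=
    hind.mono (completion_mono h₁) (completion_mono h₂)
  refine ⟨hD, hdisj.mono Set.inter_subset_right Set.inter_subset_right, hspan,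
    hcomp.mono (le_completion _) (le_completion _), le_antisymm ?_ ?_, hcomp⟩
  · unfold zcomp at hsup hind ⊢
    rw [hspan]
    exact completion_sup_le_of_disjoint hsup.le hind
      (hspan ▸ Submodule.span_mono hDB) h₁ h₂
  · exact sup_le (completion_mono (Submodule.span_mono Set.inter_subset_left))
      (completion_mono (Submodule.span_mono Set.inter_subset_left))
end

section
/- Let A be a finite subset of Λ \ {0}, S* a nested set in A, and B a nonempty irreducible subset of A. Then there exists λ ∈ B such that λ ∉ D for every D ∈ S* with D ⊊ B. -/
open TensorProduct

variable {Λ : Type*} [AddCommGroup Λ]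

/-- The set of elements of `Λ` lying in the `ℂ`-span of `B` inside `ℂ ⊗[ℤ] Λ`. -/
def inCSpan (B : Set Λ) : Set Λ :=
  {x : Λ | (1 : ℂ) ⊗ₜ[ℤ] x ∈ Submodule.span ℂ ((fun b : Λ => (1 : ℂ) ⊗ₜ[ℤ] b) '' B)}

/-- `B` is complete in `A` if `B = A ∩ ⟨B⟩_ℂ`. -/
def IsCompleteIn (A B : Set Λ) : Prop := B = A ∩ inCSpan B

/-- A nested set in `A`: a family of nonempty irreducible subsets of `A` such that for every
pairwise incomparable (under inclusion) finite subfamily, the union of the subfamily is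
complete in `A` and the subfamily consists exactly of the parts of the integral decomposition
of the union into irreducible subsets. -/
def IsNestedIn (A : Set Λ) (S : Set (Set Λ)) : Prop :=
  (∀ B ∈ S, B.Nonempty ∧ B ⊆ A ∧ IrreducibleSubset B) ∧
  ∀ F : Finset (Set Λ), ↑F ⊆ S → F.Nonempty →
    ((F : Set (Set Λ)).Pairwise fun p q => ¬ p ⊆ q ∧ ¬ q ⊆ p) →
    IsCompleteIn A (⋃₀ ↑F) ∧ IsIntegralDecomp (⋃₀ ↑F) F

variable [Module.Free ℤ Λ] [Module.Finite ℤ Λ]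

/-- If `S` is a nested set in `A` and `B` is a nonempty irreducible subset of `A`, then
there exists `l ∈ B` avoiding every element of `S` properly contained in `B`. -/
theorem exists_element_avoiding_proper_nested
    (A : Set Λ) (hAfin : A.Finite) (hA0 : (0 : Λ) ∉ A)
    (S : Set (Set Λ)) (hS : IsNestedIn A S)
    (B : Set Λ) (hBA : B ⊆ A) (hBne : B.Nonempty) (hBirr : IrreducibleSubset B) :
    ∃ l ∈ B, ∀ D ∈ S, D ⊂ B → l ∉ D := by
  by_contra! hcover
  let T : Set (Set Λ) := {D | D ∈ S ∧ D ⊂ B}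
  have hTfin : T.Finite :=
    (hAfin.subset hBA).finite_subsets.subset fun D hD => hD.2.subset
  have hMfin : {D | Maximal (· ∈ T) D}.Finite := hTfin.subset fun D hD => hD.prop
  have hMmem : ∀ D ∈ hMfin.toFinset, Maximal (· ∈ T) D := fun D hD => by simpa using hD
  have hUnion : ⋃₀ (hMfin.toFinset : Set (Set Λ)) = B := by
    refine Set.Subset.antisymm (Set.sUnion_subset fun D hD => (hMmem D hD).prop.2.subset) ?_
    intro l hl
    obtain ⟨D, hDS, hDB, hlD⟩ := hcover l hl
    obtain ⟨M, hDM, hM⟩ := hTfin.exists_le_maximal (show D ∈ T from ⟨hDS, hDB⟩)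
    exact ⟨M, by simpa using hM, hDM hlD⟩
  have hMne : hMfin.toFinset.Nonempty := by
    obtain ⟨l, hl⟩ := hBne
    rw [← hUnion] at hl
    obtain ⟨M, hM, -⟩ := hl
    exact ⟨M, hM⟩
  obtain ⟨-, hdecomp⟩ := hS.2 hMfin.toFinset (fun D hD => (hMmem D hD).prop.1) hMne
    fun D hD E hE hne =>
      ⟨fun h => hne ((hMmem D hD).eq_of_le (hMmem E hE).prop h),
        fun h => hne ((hMmem E hE).eq_of_le (hMmem D hD).prop h).symm⟩
  rw [hUnion] at hdecomp
  by_cases hcard : 2 ≤ hMfin.toFinset.card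
  · exact hBirr ⟨_, hcard, hdecomp⟩
  · obtain ⟨M, hM⟩ := Finset.card_eq_one.mp
      (show hMfin.toFinset.card = 1 by have := hMne.card_pos; omega)
    rw [hM, Finset.coe_singleton, Set.sUnion_singleton] at hUnion
    exact (hMmem M (by simp [hM])).prop.2.ne hUnion
end

section
/- Let ν ∈ ℤ^n be a primitive vector, i.e. the greatest common divisor of its coordinates is 1, and let a ∈ ℂˣ. Then the hypersurface H_{ν,a} = {t ∈ (ℂˣ)^n : χ_ν(t) = a} is connected. -/
/-- Bézout: the coordinates of a primitive integer vector have an integer combination equal to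
`1`. -/
theorem exists_sum_mul_eq_one_of_gcd_eq_one {ι : Type*} [Fintype ι] (ν : ι → ℤ)
    (h : Finset.univ.gcd ν = 1) : ∃ u : ι → ℤ, ∑ i, ν i * u i = 1 := by
  obtain ⟨u, hu⟩ := Finset.gcd_eq_sum_mul Finset.univ ν
  exact ⟨u, by rw [← hu, h]⟩

/-- The complex exponential as a map into the units of `ℂ`. -/
noncomputable def complexExpUnit (z : ℂ) : ℂˣ := Units.mk0 (Complex.exp z) (Complex.exp_ne_zero z)

theorem continuous_complexExpUnit : Continuous complexExpUnit :=
  Units.isEmbedding_val₀.continuous_iff.2 Complex.continuous_exp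

theorem val_prod_complexExpUnit_zpow {ι : Type*} [Fintype ι] (ν : ι → ℤ) (z : ι → ℂ) :
    ((∏ i, complexExpUnit (z i) ^ ν i : ℂˣ) : ℂ) = Complex.exp (∑ i, ν i * z i) := by
  simp [complexExpUnit, Complex.exp_sum, Complex.exp_int_mul]

/-- If `ν ∈ ℤ^n` is primitive (the gcd of its coordinates is `1`) and `a ∈ ℂˣ`, then the
hypersurface `{t ∈ (ℂˣ)^n : χ_ν(t) = a}` is connected. -/
theorem hypersurface_connected_of_primitive
    (n : ℕ) (ν : Fin n → ℤ) (hprim : Finset.univ.gcd ν = 1) (a : ℂˣ) :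
    IsConnected {t : Fin n → ℂˣ | ∏ i, t i ^ ν i = a} := by
  obtain ⟨u, hu⟩ := exists_sum_mul_eq_one_of_gcd_eq_one ν hprim
  have hu' : ∑ i, (ν i : ℂ) * u i = 1 := by exact_mod_cast hu
  have hα : Complex.exp (Complex.log a) = a := Complex.exp_log a.ne_zero
  set α := Complex.log a
  set V : Set (Fin n → ℂ) := {z | ∑ i, (ν i : ℂ) * z i = α}
  have hmul (c : ℂ) : ∑ i, (ν i : ℂ) * (c * u i) = c := by
    simp_rw [mul_left_comm _ c, ← Finset.mul_sum, hu', mul_one]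
  have hV : IsConnected V := by
    refine ⟨⟨fun i => α * u i, hmul α⟩, Convex.isPreconnected ?_⟩
    intro x hx y hy s t _ _ hst
    have hst' : (s : ℂ) + t = 1 := by exact_mod_cast hst
    simp only [V, Set.mem_ofPred_eq] at hx hy ⊢
    simp only [Pi.add_apply, Pi.smul_apply, Complex.real_smul, mul_add, Finset.sum_add_distrib,
      mul_left_comm _ (s : ℂ), mul_left_comm _ (t : ℂ), ← Finset.mul_sum, hx, hy]
    rw [← add_mul, hst', one_mul]
  have hcont : Continuous fun (z : Fin n → ℂ) i => complexExpUnit (z i) :=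
    continuous_pi fun i => continuous_complexExpUnit.comp (continuous_apply i)
  convert hV.image _ hcont.continuousOn
  ext t
  constructor
  · intro ht
    have hexp (i : Fin n) : complexExpUnit (Complex.log (t i)) = t i :=
      Units.ext (Complex.exp_log (t i).ne_zero)
    have hlog : Complex.exp (∑ i, ν i * Complex.log (t i)) = Complex.exp α := by
      rw [← val_prod_complexExpUnit_zpow, hα]
      simp_rw [hexp]
      exact congrArg Units.val ht
    obtain ⟨k, hk⟩ := Complex.exp_eq_exp_iff_exists_int.1 hlog
    refine ⟨fun i => Complex.log (t i) - k * (2 * Real.pi * Complex.I) * u i, ?_, ?_⟩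
    · change ∑ i, (ν i : ℂ) * (_ - _) = α
      simp_rw [mul_sub, Finset.sum_sub_distrib, hmul, hk, add_sub_cancel_right]
    · funext i
      rw [← hexp i]
      refine Units.ext (Complex.exp_eq_exp_iff_exists_int.2 ⟨-(k * u i), ?_⟩)
      push_cast
      ring
  · rintro ⟨z, hz, rfl⟩
    refine Units.ext ?_
    rw [val_prod_complexExpUnit_zpow, ← hα]
    exact congrArg Complex.exp hz
end
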